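/- Let k be a field of characteristic zero, let τ be the k-algebra automorphism of F = k(x,y) with τ(x) = x^{-1} and τ(y) = y^{-1}, and set u = (x − x^{-1})(y^{-1} − y)^{-1} and v = (xy − (xy)^{-1})(y^{-1} − y)^{-1} in F. Then u and v are fixed by τ, they satisfy {v,u} = vu, and the fixed field F^τ equals the subfield k(u,v) of F generated by u and v over k; in particular F^τ is Poisson-isomorphic to F. -/

import Mathlib

noncomputable section

/-- A Poisson bracket on a commutative `k`-algebra `R`: a `k`-bilinear antisymmetric map
satisfying the Jacobi identity and the Leibniz rule in each argument. -/
structure PoissonBracket (k R : Type*) [CommRing k] [CommRing R] [Algebra k R] where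
  bracket : R →ₗ[k] R →ₗ[k] R
  antisymm : ∀ a b : R, bracket a b = - bracket b a
  jacobi : ∀ a b c : R,
    bracket a (bracket b c) + bracket b (bracket c a) + bracket c (bracket a b) = 0
  leibniz : ∀ a b c : R, bracket a (b * c) = bracket a b * c + b * bracket a c

/-- The subalgebra of elements fixed by an algebra automorphism. -/
def fixedSubalgebra {k F : Type*} [CommSemiring k] [CommSemiring F] [Algebra k F]
    (σ : F ≃ₐ[k] F) : Subalgebra k F where
  carrier := {a | σ a = a}
  mul_mem' := fun {a b} ha hb => by
    show σ (a * b) = a * b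
    rw [map_mul, show σ a = a from ha, show σ b = b from hb]
  add_mem' := fun {a b} ha hb => by
    show σ (a + b) = a + b
    rw [map_add, show σ a = a from ha, show σ b = b from hb]
  one_mem' := map_one σ
  zero_mem' := map_zero σ
  algebraMap_mem' := fun r => σ.commutes r

namespace PoissonBracket

variable {k F : Type*} [Field k] [Field F] [Algebra k F] (P : PoissonBracket k F)

theorem leibniz_left (a b c : F) :
    P.bracket (a * b) c = P.bracket a c * b + a * P.bracket b c := by
  rw [P.antisymm, P.leibniz, P.antisymm c a, P.antisymm c b]
  ring

theorem bracket_one (a : F) : P.bracket a 1 = 0 := by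
  have h := P.leibniz a 1 1
  simpa using h

theorem bracket_algebraMap (a : F) (r : k) : P.bracket a (algebraMap k F r) = 0 := by
  rw [Algebra.algebraMap_eq_smul_one, map_smul, bracket_one, smul_zero]

theorem bracket_inv (a b : F) : P.bracket a b⁻¹ = - (P.bracket a b * (b⁻¹ * b⁻¹)) := by
  by_cases hb : b = 0
  · simp [hb]
  have h := P.leibniz a b b⁻¹
  rw [mul_inv_cancel₀ hb, bracket_one] at h
  field_simp at h ⊢
  linear_combination -h

theorem bracket_inv_left (a b : F) : P.bracket a⁻¹ b = - (P.bracket a b * (a⁻¹ * a⁻¹)) := by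
  rw [P.antisymm, bracket_inv, P.antisymm b a]
  ring

theorem bracket_self [CharZero k] (a : F) : P.bracket a a = 0 := by
  have : CharZero F := charZero_of_injective_algebraMap (algebraMap k F).injective
  exact self_eq_neg.mp (P.antisymm a a)

theorem map_bracket_of_mem_adjoin_right (f : F →ₐ[k] F) {s : Set F} {a : F}
    (h : ∀ b ∈ s, f (P.bracket a b) = P.bracket (f a) (f b)) {b : F}
    (hb : b ∈ IntermediateField.adjoin k s) : f (P.bracket a b) = P.bracket (f a) (f b) := by
  induction hb using IntermediateField.adjoin_induction with
  | mem b hb => exact h b hb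
  | algebraMap r => simp [bracket_algebraMap]
  | add b c _ _ hb hc => simp [hb, hc]
  | inv b _ hb => simp [bracket_inv, hb]
  | mul b c _ _ hb hc => simp [leibniz, hb, hc]

/-- An algebra endomorphism respects the bracket as soon as it does so on field generators. -/
theorem map_bracket_of_adjoin_eq_top (f : F →ₐ[k] F) {s : Set F}
    (hs : IntermediateField.adjoin k s = ⊤)
    (h : ∀ a ∈ s, ∀ b ∈ s, f (P.bracket a b) = P.bracket (f a) (f b)) (a b : F) :
    f (P.bracket a b) = P.bracket (f a) (f b) := by
  have hmem : ∀ c : F, c ∈ IntermediateField.adjoin k s := fun c => hs ▸ IntermediateField.mem_top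
  refine P.map_bracket_of_mem_adjoin_right f (s := s) (fun b hb => ?_) (hmem b)
  rw [P.antisymm a b, P.antisymm (f a) (f b), map_neg,
    P.map_bracket_of_mem_adjoin_right f (h b hb) (hmem a)]

/-- A field embedding sending a pair of generators to a pair with the same
log-canonical bracket respects the Poisson bracket. -/
theorem map_bracket_of_log_canonical [CharZero k] {x y u v : F}
    (hgen : IntermediateField.adjoin k {x, y} = ⊤) (hP : P.bracket y x = y * x)
    (hQ : P.bracket v u = v * u) (f : F →ₐ[k] F) (hfx : f x = u) (hfy : f y = v) (a b : F) :
    f (P.bracket a b) = P.bracket (f a) (f b) := by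
  refine P.map_bracket_of_adjoin_eq_top f hgen ?_ a b
  rintro a (rfl | rfl) b (rfl | rfl)
  · simp [bracket_self]
  · rw [P.antisymm, hP, hfx, hfy, P.antisymm, hQ, map_neg, map_mul, hfx, hfy]
  · rw [hP, map_mul, hfx, hfy, hQ]
  · simp [bracket_self]

/-- The bracket of `u = (x - x⁻¹) / (y⁻¹ - y)` and `v = (x y - (x y)⁻¹) / (y⁻¹ - y)`. -/
theorem bracket_inversion_invariants [CharZero k] {x y : F} (hP : P.bracket y x = y * x)
    (hx : x ≠ 0) (hy : y ≠ 0) (hw : y⁻¹ - y ≠ 0) :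
    P.bracket ((x * y - (x * y)⁻¹) * (y⁻¹ - y)⁻¹) ((x - x⁻¹) * (y⁻¹ - y)⁻¹) =
      ((x * y - (x * y)⁻¹) * (y⁻¹ - y)⁻¹) * ((x - x⁻¹) * (y⁻¹ - y)⁻¹) := by
  have hP' : P.bracket x y = -(y * x) := by rw [P.antisymm, hP]
  have hw' : 1 - y ^ 2 ≠ 0 := fun h => hw (by field_simp; simpa using h)
  simp only [leibniz, leibniz_left, bracket_inv, bracket_inv_left, map_sub, LinearMap.sub_apply,
    bracket_self, hP, hP']
  have hwe : y⁻¹ - y = (1 - y ^ 2) / y := by field_simp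
  rw [hwe]
  field_simp
  ring

end PoissonBracket

section InversionInvariants

variable {k F : Type*} [Field k] [Field F] [Algebra k F]

theorem adjoin_range_pair (a b : F) :
    IntermediateField.adjoin k (Set.range ![a, b]) = IntermediateField.adjoin k {a, b} := by
  rw [Matrix.range_cons_cons_empty]

theorem AlgebraicIndependent.monomial_sq_ne_one [CharZero k] {x y : F}
    (hind : AlgebraicIndependent k ![x, y]) {m n : ℕ} (hmn : m + n ≠ 0) :
    (x ^ m * y ^ n) ^ 2 ≠ 1 := by
  intro h
  have h0 : ((MvPolynomial.X 0 ^ m * MvPolynomial.X 1 ^ n) ^ 2 - 1 : MvPolynomial (Fin 2) k) = 0 :=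
    (injective_iff_map_eq_zero _).mp hind _ (by simp [h])
  have h1 := congrArg (MvPolynomial.eval fun _ => (2 : k)) h0
  simp only [map_sub, map_pow, map_mul, MvPolynomial.eval_X, map_one, map_zero, ← pow_add,
    ← pow_mul, sub_eq_zero] at h1
  have h2 : 2 ^ ((m + n) * 2) = 1 := by exact_mod_cast h1
  simp at h2
  omega

/-- If `F` is generated by `x, y`, and an intermediate field `K` of elements fixed by `τ`
contains the square of `s` with `τ s = -s`, and `x, y ∈ K + K s`, then `K` is the whole
fixed field of `τ`. -/
theorem mem_of_fixed_of_anti_invariant [CharZero k] (K : IntermediateField k F) (τ : F ≃ₐ[k] F)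
    (hK : ∀ t ∈ K, τ t = t) {g : Set F} (hgen : IntermediateField.adjoin k g = ⊤) {s : F}
    (hs : s ^ 2 ∈ K) (hτs : τ s = -s)
    (hg : ∀ t ∈ g, ∃ a ∈ K, ∃ b ∈ K, t = a + b * s) {t : F} (ht : τ t = t) : t ∈ K := by
  have hall : ∀ t : F, ∃ a ∈ K, ∃ b ∈ K, t = a + b * s := by
    intro t
    have htop : t ∈ IntermediateField.adjoin k g := hgen ▸ IntermediateField.mem_top
    induction htop using IntermediateField.adjoin_induction with
    | mem t ht => exact hg t ht
    | algebraMap r => exact ⟨_, K.algebraMap_mem r, 0, K.zero_mem, by ring⟩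
    | add _ _ _ _ h₁ h₂ =>
      obtain ⟨a, ha, b, hb, rfl⟩ := h₁
      obtain ⟨c, hc, d, hd, rfl⟩ := h₂
      exact ⟨a + c, add_mem ha hc, b + d, add_mem hb hd, by ring⟩
    | mul _ _ _ _ h₁ h₂ =>
      obtain ⟨a, ha, b, hb, rfl⟩ := h₁
      obtain ⟨c, hc, d, hd, rfl⟩ := h₂
      exact ⟨a * c + b * d * s ^ 2, add_mem (mul_mem ha hc) (mul_mem (mul_mem hb hd) hs),
        a * d + b * c, add_mem (mul_mem ha hd) (mul_mem hb hc), by ring⟩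
    | inv _ _ h =>
      obtain ⟨a, ha, b, hb, rfl⟩ := h
      have hN : a ^ 2 - b ^ 2 * s ^ 2 ∈ K :=
        sub_mem (pow_mem ha 2) (mul_mem (pow_mem hb 2) hs)
      refine ⟨a * (a ^ 2 - b ^ 2 * s ^ 2)⁻¹, mul_mem ha (inv_mem hN),
        -b * (a ^ 2 - b ^ 2 * s ^ 2)⁻¹, mul_mem (neg_mem hb) (inv_mem hN), ?_⟩
      by_cases h0 : a + b * s = 0
      · have : a ^ 2 - b ^ 2 * s ^ 2 = 0 := by linear_combination (a - b * s) * h0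
        simp [this, h0]
      · have h1 : a - b * s ≠ 0 := by
          have : τ (a + b * s) = a - b * s := by
            rw [map_add, map_mul, hK a ha, hK b hb, hτs]; ring
          rw [← this]
          exact (map_ne_zero τ).mpr h0
        have h2 : a ^ 2 - b ^ 2 * s ^ 2 = (a + b * s) * (a - b * s) := by ring
        rw [h2]
        field_simp
        ring
  obtain ⟨a, ha, b, hb, rfl⟩ := hall t
  have : CharZero F := charZero_of_injective_algebraMap (algebraMap k F).injective
  have hbs : 2 * (b * s) = 0 := by
    rw [map_add, map_mul, hK a ha, hK b hb, hτs] at ht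
    linear_combination -ht
  rw [(mul_eq_zero.mp hbs).resolve_left two_ne_zero, add_zero]
  exact ha

/-- A field is algebraic over any intermediate field containing the fixed field of an
involution. -/
theorem isAlgebraic_of_fixed_mem (K : IntermediateField k F) (τ : F ≃ₐ[k] F)
    (hτ : ∀ t, τ (τ t) = t) (hK : ∀ t, τ t = t → t ∈ K) : Algebra.IsAlgebraic K F := by
  refine ⟨fun t => ?_⟩
  let a : K := ⟨t + τ t, hK _ (by rw [map_add, hτ, add_comm])⟩
  let b : K := ⟨t * τ t, hK _ (by rw [map_mul, hτ, mul_comm])⟩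
  refine ⟨Polynomial.X ^ 2 - Polynomial.C a * Polynomial.X + Polynomial.C b, ?_, ?_⟩
  · intro h
    have := congrArg (fun p => Polynomial.coeff p 2) h
    simp at this
  · have ha : algebraMap K F a = t + τ t := rfl
    have hb : algebraMap K F b = t * τ t := rfl
    simp only [map_add, map_sub, map_mul, map_pow, Polynomial.aeval_X, Polynomial.aeval_C, ha, hb]
    ring

theorem AlgEquiv.involutive_of_adjoin_eq_top (τ : F ≃ₐ[k] F) {s : Set F}
    (hs : IntermediateField.adjoin k s = ⊤) (h : ∀ a ∈ s, τ (τ a) = a) (t : F) :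
    τ (τ t) = t := by
  have ht : t ∈ IntermediateField.adjoin k s := hs ▸ IntermediateField.mem_top
  induction ht using IntermediateField.adjoin_induction with
  | mem a ha => exact h a ha
  | algebraMap r => simp
  | add a b _ _ ha hb => simp [ha, hb]
  | inv a _ ha => simp [ha]
  | mul a b _ _ ha hb => simp [ha, hb]

theorem algebraicIndependent_pair_of_isAlgebraic {x y u v : F}
    (hind : AlgebraicIndependent k ![x, y])
    [Algebra.IsAlgebraic (IntermediateField.adjoin k {u, v}) F] :
    AlgebraicIndependent k ![u, v] := by
  have : Algebra.IsAlgebraic (Algebra.adjoin k (Set.range ![u, v])) F := by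
    rw [Matrix.range_cons_cons_empty]
    exact IntermediateField.isAlgebraic_adjoin_iff_top.mp inferInstance
  exact (Algebra.IsAlgebraic.isTranscendenceBasis_of_lift_le_trdeg_of_finite k ![u, v]
    hind.lift_cardinalMk_le_trdeg).1

/-- The isomorphism between the fields generated by two algebraically independent pairs. -/
theorem exists_algEquiv_adjoin_pair {x y u v : F} (hxy : AlgebraicIndependent k ![x, y])
    (huv : AlgebraicIndependent k ![u, v]) (hgen : IntermediateField.adjoin k {x, y} = ⊤) :
    ∃ e : F ≃ₐ[k] IntermediateField.adjoin k {u, v}, (e x : F) = u ∧ (e y : F) = v := by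
  have hx := adjoin_range_pair (k := k) x y
  let e₁ : FractionRing (MvPolynomial (Fin 2) k) ≃ₐ[k] F :=
    (hxy.aevalEquivField.trans (IntermediateField.equivOfEq (hx.trans hgen))).trans
      IntermediateField.topEquiv
  let e₂ := huv.aevalEquivField.trans (IntermediateField.equivOfEq (adjoin_range_pair u v))
  have h₁ : ∀ i, e₁ (algebraMap (MvPolynomial (Fin 2) k) _ (MvPolynomial.X i)) =
      ![x, y] i := fun i =>
    (hxy.aevalEquivField_algebraMap_apply_coe _).trans (MvPolynomial.aeval_X _ i)
  have h₂ : ∀ i, (e₂ (algebraMap (MvPolynomial (Fin 2) k) _ (MvPolynomial.X i)) : F) =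
      ![u, v] i := fun i =>
    (huv.aevalEquivField_algebraMap_apply_coe _).trans (MvPolynomial.aeval_X _ i)
  have h : ∀ i, ((e₁.symm.trans e₂) (![x, y] i) : F) = ![u, v] i := fun i => by
    rw [← h₁, ← h₂, AlgEquiv.trans_apply, AlgEquiv.symm_apply_apply]
  exact ⟨e₁.symm.trans e₂, h 0, h 1⟩

end InversionInvariants

/-- Let `k` be a field of characteristic zero, let `F = k(x,y)` carry the
Poisson bracket with `{y,x} = yx`, let `τ` be the `k`-algebra automorphism of `F` with
`τ(x) = x⁻¹`, `τ(y) = y⁻¹`, and set `u = (x − x⁻¹)(y⁻¹ − y)⁻¹`,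
`v = (xy − (xy)⁻¹)(y⁻¹ − y)⁻¹`.  Then `u` and `v` are fixed by `τ`, satisfy `{v,u} = vu`,
and `F^τ = k(u,v)`; in particular `F^τ` is Poisson-isomorphic to `F`. -/
theorem statement4
    (k : Type*) [Field k] [CharZero k]
    (F : Type*) [Field F] [Algebra k F] (x y : F)
    (hind : AlgebraicIndependent k ![x, y])
    (hgen : IntermediateField.adjoin k {x, y} = ⊤)
    (P : PoissonBracket k F) (hP : P.bracket y x = y * x)
    (τ : F ≃ₐ[k] F) (hτx : τ x = x⁻¹) (hτy : τ y = y⁻¹)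
    (u v : F)
    (hu : u = (x - x⁻¹) * (y⁻¹ - y)⁻¹)
    (hv : v = (x * y - (x * y)⁻¹) * (y⁻¹ - y)⁻¹) :
    τ u = u ∧ τ v = v ∧ P.bracket v u = v * u ∧
      (∀ t : F, t ∈ IntermediateField.adjoin k {u, v} ↔ τ t = t) ∧
      ∃ e : ↥(fixedSubalgebra τ) ≃ₐ[k] F,
        ∀ (p q : ↥(fixedSubalgebra τ)) (hpq : P.bracket (p : F) (q : F) ∈ fixedSubalgebra τ),
          e ⟨P.bracket (p : F) (q : F), hpq⟩ = P.bracket (e p) (e q) := by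
  have : CharZero F := charZero_of_injective_algebraMap (algebraMap k F).injective
  have hx0 : x ≠ 0 := hind.ne_zero 0
  have hy0 : y ≠ 0 := hind.ne_zero 1
  have hx2 : x ^ 2 - 1 ≠ 0 := by
    simpa [sub_eq_zero] using hind.monomial_sq_ne_one (m := 1) (n := 0) (by simp)
  have hy2 : 1 - y ^ 2 ≠ 0 := by
    rw [Ne, sub_eq_zero, eq_comm]
    simpa using hind.monomial_sq_ne_one (m := 0) (n := 1) (by simp)
  have hxy2 : x ^ 2 * y ^ 2 - 1 ≠ 0 := by
    simpa [sub_eq_zero, mul_pow] using hind.monomial_sq_ne_one (m := 1) (n := 1) (by simp)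
  have hw : y⁻¹ - y = (1 - y ^ 2) / y := by field_simp
  have hw0 : y⁻¹ - y ≠ 0 := by rw [hw]; exact div_ne_zero hy2 hy0
  have hu' : u = (x ^ 2 - 1) * y / (x * (1 - y ^ 2)) := by rw [hu, hw]; field_simp
  have hv' : v = (x ^ 2 * y ^ 2 - 1) / (x * (1 - y ^ 2)) := by rw [hv, hw]; field_simp
  have hu0 : u ≠ 0 := by
    rw [hu']; exact div_ne_zero (mul_ne_zero hx2 hy0) (mul_ne_zero hx0 hy2)
  have hv0 : v ≠ 0 := by rw [hv']; exact div_ne_zero hxy2 (mul_ne_zero hx0 hy2)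
  have hτw : τ (y⁻¹ - y) = -(y⁻¹ - y) := by simp [hτy]
  have hτu : τ u = u := by
    rw [hu, map_mul, map_inv₀, hτw, map_sub, map_inv₀, hτx, inv_inv, inv_neg]
    ring
  have hτv : τ v = v := by
    rw [hv, map_mul, map_inv₀, hτw, map_sub, map_inv₀, map_mul, hτx, hτy, inv_neg, ← mul_inv,
      inv_inv]
    ring
  have hPuv : P.bracket v u = v * u := by
    rw [hu, hv]; exact P.bracket_inversion_invariants hP hx0 hy0 hw0
  set K := IntermediateField.adjoin k {u, v}
  have huK : u ∈ K := IntermediateField.subset_adjoin _ _ (by simp)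
  have hvK : v ∈ K := IntermediateField.subset_adjoin _ _ (by simp)
  have hfix : ∀ t ∈ K, τ t = t := by
    intro t ht
    induction ht using IntermediateField.adjoin_induction with
    | mem a ha => rcases ha with rfl | rfl <;> assumption
    | algebraMap r => simp
    | add a b _ _ ha hb => simp [ha, hb]
    | inv a _ ha => simp [ha]
    | mul a b _ _ ha hb => simp [ha, hb]
  have hcosh : y + y⁻¹ = (u ^ 2 + v ^ 2 - 1) * (u * v)⁻¹ := by
    rw [eq_mul_inv_iff_mul_eq₀ (mul_ne_zero hu0 hv0), hu', hv']
    field_simp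
    ring
  have hcK : y + y⁻¹ ∈ K := by
    rw [hcosh]
    exact mul_mem (sub_mem (add_mem (pow_mem huK 2) (pow_mem hvK 2)) (one_mem K))
      (inv_mem (mul_mem huK hvK))
  have h2K : (2 : F)⁻¹ ∈ K := inv_mem (ofNat_mem K 2)
  have hsK : (y⁻¹ - y) ^ 2 ∈ K := by
    have : (y⁻¹ - y) ^ 2 = (y + y⁻¹) ^ 2 - 4 := by field_simp; ring
    rw [this]
    exact sub_mem (pow_mem hcK 2) (ofNat_mem K 4)
  have hfield : ∀ t : F, t ∈ K ↔ τ t = t := by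
    refine fun t => ⟨hfix t, mem_of_fixed_of_anti_invariant K τ hfix hgen hsK hτw ?_⟩
    rintro t (rfl | rfl)
    · refine ⟨u * (y + y⁻¹) * 2⁻¹ - v, sub_mem (mul_mem (mul_mem huK hcK) h2K) hvK,
        u * 2⁻¹, mul_mem huK h2K, ?_⟩
      rw [hu', hv']
      field_simp
      ring
    · refine ⟨(t + t⁻¹) * 2⁻¹, mul_mem hcK h2K, -2⁻¹, neg_mem h2K, ?_⟩
      field_simp
      ring
  have hinv : ∀ t, τ (τ t) = t := by
    refine τ.involutive_of_adjoin_eq_top hgen ?_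
    rintro a (rfl | rfl)
    · simp [hτx]
    · simp [hτy]
  have : Algebra.IsAlgebraic K F := isAlgebraic_of_fixed_mem K τ hinv fun t => (hfield t).mpr
  obtain ⟨f, hfx, hfy⟩ :=
    exists_algEquiv_adjoin_pair hind
      (algebraicIndependent_pair_of_isAlgebraic (u := u) (v := v) hind) hgen
  refine ⟨hτu, hτv, hPuv, hfield, ?_⟩
  have hsub : fixedSubalgebra τ = K.toSubalgebra := SetLike.ext fun t => (hfield t).symm
  let e : fixedSubalgebra τ ≃ₐ[k] F := (Subalgebra.equivOfEq _ _ hsub).trans f.symm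
  have he : ∀ p, ((f (e p) : K) : F) = p := fun p =>
    congrArg Subtype.val (f.apply_symm_apply (Subalgebra.equivOfEq _ _ hsub p))
  refine ⟨e, fun p q hpq => f.injective (Subtype.ext ?_)⟩
  have hf := P.map_bracket_of_log_canonical hgen hP hPuv (K.val.comp f.toAlgHom) hfx hfy (e p) (e q)
  rw [he]
  refine Eq.trans ?_ hf.symm
  exact (congrArg₂ (fun a b => P.bracket a b) (he p) (he q)).symm
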